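/- arXiv:2509.05377 — 2 statements merged into one kernel-verified Lean document; each statement's English description precedes it below -/
import Mathlib

section
/- Let f : E → ℝ be differentiable, convex, and L-smooth with L > 0, let θ* ∈ E be a minimizer of f, and let η be a step size with 0 ≤ η ≤ 1/L. Then one gradient-descent step contracts the squared distance to the optimum: for every x ∈ E, ‖x − η∇f(x) − θ*‖² ≤ ‖x − θ*‖² − (η/L)·‖∇f(x)‖². -/
open RealInnerProductSpace

/-- The derivative of a differentiable function along a line, in terms of its gradient. -/
theorem hasDerivAt_comp_line_gradient {E : Type*} [NormedAddCommGroup E]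
    [InnerProductSpace ℝ E] [CompleteSpace E] {f : E → ℝ} (hdiff : Differentiable ℝ f)
    (x v : E) (t : ℝ) :
    HasDerivAt (fun s : ℝ => f (x + s • v)) ⟪gradient f (x + t • v), v⟫ t := by
  have hline : HasDerivAt (fun s : ℝ => x + s • v) v t := by
    simpa using ((hasDerivAt_id t).smul_const v).const_add x
  have h := (hdiff (x + t • v)).hasGradientAt.hasFDerivAt.comp_hasDerivAt t hline
  simpa [Function.comp_def] using h

/-- The descent lemma: a function with `L`-Lipschitz gradient is bounded above by its
quadratic model. -/
theorem le_add_inner_gradient_add_sq {E : Type*} [NormedAddCommGroup E]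
    [InnerProductSpace ℝ E] [CompleteSpace E] {f : E → ℝ} {L : ℝ}
    (hdiff : Differentiable ℝ f)
    (hsmooth : ∀ x y : E, ‖gradient f x - gradient f y‖ ≤ L * ‖x - y‖) (x v : E) :
    f (x + v) ≤ f x + ⟪gradient f x, v⟫ + L / 2 * ‖v‖ ^ 2 := by
  have hderiv : ∀ t : ℝ, HasDerivAt
      (fun s : ℝ => f (x + s • v) - s * ⟪gradient f x, v⟫ - s ^ 2 * (L / 2 * ‖v‖ ^ 2))
      (⟪gradient f (x + t • v), v⟫ - ⟪gradient f x, v⟫ - 2 * t * (L / 2 * ‖v‖ ^ 2)) t := by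
    intro t
    have h₁ := (hasDerivAt_id t).mul_const ⟪gradient f x, v⟫
    have h₂ := (hasDerivAt_pow 2 t).mul_const (L / 2 * ‖v‖ ^ 2)
    simpa using ((hasDerivAt_comp_line_gradient hdiff x v t).fun_sub h₁).fun_sub h₂
  have hanti := antitoneOn_of_deriv_nonpos (convex_Icc (0 : ℝ) 1)
    (fun t _ => (hderiv t).continuousAt.continuousWithinAt)
    (fun t _ => (hderiv t).differentiableAt.differentiableWithinAt) (fun t ht => by
      rw [(hderiv t).deriv, ← inner_sub_left]
      rw [interior_Icc] at ht
      have h₁ := real_inner_le_norm (gradient f (x + t • v) - gradient f x) v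
      have h₂ := hsmooth (x + t • v) x
      rw [add_sub_cancel_left, norm_smul, Real.norm_of_nonneg ht.1.le] at h₂
      nlinarith [mul_le_mul_of_nonneg_right h₂ (norm_nonneg v)])
  have h := hanti (Set.left_mem_Icc.2 zero_le_one) (Set.right_mem_Icc.2 zero_le_one) zero_le_one
  simp only [one_smul, zero_smul, add_zero] at h
  linarith

/-- A differentiable convex function lies above its tangent hyperplanes. -/
theorem ConvexOn.add_inner_gradient_le {E : Type*} [NormedAddCommGroup E]
    [InnerProductSpace ℝ E] [CompleteSpace E] {f : E → ℝ} (hconv : ConvexOn ℝ Set.univ f)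
    (hdiff : Differentiable ℝ f) (x v : E) :
    f x + ⟪gradient f x, v⟫ ≤ f (x + v) := by
  have hline : ConvexOn ℝ Set.univ (fun s : ℝ => f (x + s • v)) := by
    refine ⟨convex_univ, fun s _ t _ a b ha hb hab => ?_⟩
    have h := hconv.2 (Set.mem_univ (x + s • v)) (Set.mem_univ (x + t • v)) ha hb hab
    have hpt : a • (x + s • v) + b • (x + t • v) = x + (a • s + b • t) • v := by
      rw [← eq_sub_iff_add_eq] at hab
      subst hab
      simp only [smul_eq_mul]
      module
    rwa [hpt] at h
  have h := hline.le_slope_of_hasDerivAt (Set.mem_univ 0) (Set.mem_univ 1) zero_lt_one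
    (hasDerivAt_comp_line_gradient hdiff x v 0)
  simp only [slope_def_field, one_smul, zero_smul, add_zero, sub_zero, div_one] at h
  linarith

/-- The gradient of a convex `L`-smooth function is cocoercive relative to a minimizer. -/
theorem ConvexOn.sq_norm_gradient_div_le_inner {E : Type*} [NormedAddCommGroup E]
    [InnerProductSpace ℝ E] [CompleteSpace E] {f : E → ℝ} {L : ℝ}
    (hconv : ConvexOn ℝ Set.univ f) (hL : 0 < L) (hdiff : Differentiable ℝ f)
    (hsmooth : ∀ x y : E, ‖gradient f x - gradient f y‖ ≤ L * ‖x - y‖)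
    {z : E} (hmin : ∀ y : E, f z ≤ f y) (x : E) :
    ‖gradient f x‖ ^ 2 / L ≤ ⟪gradient f x, x - z⟫ := by
  have hgrad : gradient f z = 0 := by
    have h : IsLocalMin f z := Filter.Eventually.of_forall hmin
    simp [gradient, h.fderiv_eq_zero]
  set g := gradient f x with hg
  have h₁ := le_add_inner_gradient_add_sq hdiff hsmooth x (-(L⁻¹ • g))
  have h₂ := le_add_inner_gradient_add_sq hdiff hsmooth z (L⁻¹ • g)
  have h₃ := hconv.add_inner_gradient_le hdiff x (L⁻¹ • g - (x - z))
  have h₄ := hmin (x + -(L⁻¹ • g))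
  have hpt : x + (L⁻¹ • g - (x - z)) = z + L⁻¹ • g := by abel
  have hsq : L / 2 * ‖L⁻¹ • g‖ ^ 2 = ‖g‖ ^ 2 / L / 2 := by
    rw [norm_smul, Real.norm_of_nonneg (inv_nonneg.2 hL.le)]
    field_simp
  have hinner : ⟪g, L⁻¹ • g⟫ = ‖g‖ ^ 2 / L := by
    rw [real_inner_smul_right, real_inner_self_eq_norm_sq]
    ring
  rw [← hg, inner_neg_right, norm_neg, hsq, hinner] at h₁
  rw [hgrad, inner_zero_left, hsq] at h₂
  rw [← hg, hpt, inner_sub_right, hinner] at h₃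
  linarith

/-- One gradient-descent step with step size `0 ≤ η ≤ 1/L` contracts the squared distance
to a minimizer: `‖x − η∇f(x) − θ*‖² ≤ ‖x − θ*‖² − (η/L)‖∇f(x)‖²`. -/
theorem gradient_descent_step_contracts {E : Type*} [NormedAddCommGroup E]
    [InnerProductSpace ℝ E] [CompleteSpace E]
    (f : E → ℝ) (L : ℝ) (hL : 0 < L)
    (hdiff : Differentiable ℝ f)
    (hconv : ConvexOn ℝ Set.univ f)
    (hsmooth : ∀ x y : E, ‖gradient f x - gradient f y‖ ≤ L * ‖x - y‖)
    (θstar : E) (hmin : ∀ θ : E, f θstar ≤ f θ)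
    (η : ℝ) (hη0 : 0 ≤ η) (hη1 : η ≤ 1 / L) :
    ∀ x : E, ‖x - η • gradient f x - θstar‖ ^ 2 ≤
      ‖x - θstar‖ ^ 2 - (η / L) * ‖gradient f x‖ ^ 2 := by
  intro x
  have hco := hconv.sq_norm_gradient_div_le_inner hL hdiff hsmooth hmin x
  have hexp : ‖x - η • gradient f x - θstar‖ ^ 2 = ‖x - θstar‖ ^ 2
      - 2 * η * ⟪gradient f x, x - θstar⟫ + η ^ 2 * ‖gradient f x‖ ^ 2 := by
    rw [sub_right_comm, norm_sub_sq_real, real_inner_smul_right, real_inner_comm, norm_smul,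
      mul_pow, Real.norm_eq_abs, sq_abs]
    ring
  have hstep : η ^ 2 * ‖gradient f x‖ ^ 2 ≤ η / L * ‖gradient f x‖ ^ 2 := by
    gcongr
    calc η ^ 2 = η * η := sq η
      _ ≤ η * (1 / L) := by gcongr
      _ = η / L := by ring
  have hscaled : η / L * ‖gradient f x‖ ^ 2 ≤ η * ⟪gradient f x, x - θstar⟫ := by
    calc η / L * ‖gradient f x‖ ^ 2 = η * (‖gradient f x‖ ^ 2 / L) := by ring
      _ ≤ η * ⟪gradient f x, x - θstar⟫ := by gcongr
  linarith
end

section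
/- Let F_1, …, F_U : E → ℝ each be differentiable, convex, and L-smooth with L > 0, and suppose θ* ∈ E is a common minimizer of every F_u. Fix a starting point θ ∈ E, a step size 0 ≤ η ≤ 1/L, and a number of local steps τ ≥ 1. For each client u define local gradient-descent iterates by x_u^{(0)} = θ and x_u^{(k+1)} = x_u^{(k)} − η·∇F_u(x_u^{(k)}) for k = 0, …, τ−1. Then (1/U)·∑_{u=1}^U ‖x_u^{(τ)} − θ*‖² ≤ ‖θ − θ*‖². -/
open RealInnerProductSpace

section SmoothConvex

variable {E : Type*} [NormedAddCommGroup E] [InnerProductSpace ℝ E] [CompleteSpace E]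
  {f : E → ℝ} {L : ℝ}

theorem Differentiable.hasDerivAt_comp_add_smul (hf : Differentiable ℝ f) (x v : E) (t : ℝ) :
    HasDerivAt (fun s : ℝ => f (x + s • v)) ⟪gradient f (x + t • v), v⟫ t := by
  have hline : HasDerivAt (fun s : ℝ => x + s • v) v t := by
    simpa using ((hasDerivAt_id t).smul_const v).const_add x
  rw [inner_gradient_left]
  exact (hf (x + t • v)).hasFDerivAt.comp_hasDerivAt t hline

/-- The first-order characterization of convexity: the graph lies above its tangents. -/
theorem ConvexOn.add_inner_gradient_le_s5 (hc : ConvexOn ℝ Set.univ f) (hf : Differentiable ℝ f)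
    (x y : E) : f x + ⟪gradient f x, y - x⟫ ≤ f y := by
  have hline : ConvexOn ℝ Set.univ (fun t : ℝ => f (x + t • (y - x))) := by
    have h := hc.comp_affineMap (AffineMap.lineMap x y)
    simpa [Function.comp_def, AffineMap.lineMap_apply, add_comm] using h
  have h := hline.le_slope_of_hasDerivAt (Set.mem_univ 0) (Set.mem_univ 1) zero_lt_one
    (hf.hasDerivAt_comp_add_smul x (y - x) 0)
  simp only [slope_def_field, zero_smul, add_zero, one_smul, add_sub_cancel, sub_zero,
    div_one] at h
  linarith

/-- The descent lemma: an `L`-smooth function lies below its quadratic model. -/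
theorem le_add_inner_gradient_add_of_smooth (hf : Differentiable ℝ f)
    (hs : ∀ x y, ‖gradient f x - gradient f y‖ ≤ L * ‖x - y‖) (x v : E) :
    f (x + v) ≤ f x + ⟪gradient f x, v⟫ + L / 2 * ‖v‖ ^ 2 := by
  let φ : ℝ → ℝ := fun t => f (x + t • v) - t * ⟪gradient f x, v⟫ - t ^ 2 * (L / 2 * ‖v‖ ^ 2)
  have hφ (t : ℝ) : HasDerivAt φ
      (⟪gradient f (x + t • v), v⟫ - ⟪gradient f x, v⟫ - 2 * t * (L / 2 * ‖v‖ ^ 2)) t :=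
    (((hf.hasDerivAt_comp_add_smul x v t).sub
      ((hasDerivAt_id t).mul_const ⟪gradient f x, v⟫)).sub
      ((hasDerivAt_pow 2 t).mul_const (L / 2 * ‖v‖ ^ 2))).congr_deriv (by simp)
  have hanti : AntitoneOn φ (Set.Ici 0) := by
    refine antitoneOn_of_deriv_nonpos (convex_Ici 0)
      (fun t _ => (hφ t).continuousAt.continuousWithinAt)
      (fun t _ => (hφ t).differentiableAt.differentiableWithinAt) fun t ht => ?_
    rw [interior_Ici, Set.mem_Ioi] at ht
    rw [(hφ t).deriv, ← inner_sub_left]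
    have hgrad := hs (x + t • v) x
    rw [add_sub_cancel_left, norm_smul, Real.norm_of_nonneg ht.le] at hgrad
    have hinner := (real_inner_le_norm (gradient f (x + t • v) - gradient f x) v).trans
      (mul_le_mul_of_nonneg_right hgrad (norm_nonneg v))
    linarith
  have h := hanti Set.self_mem_Ici (Set.mem_Ici.2 zero_le_one) zero_le_one
  simp only [φ, zero_smul, one_smul, add_zero] at h
  linarith

theorem sq_norm_gradient_le_of_smooth_of_isMinOn (hL : 0 < L) (hf : Differentiable ℝ f)
    (hs : ∀ x y, ‖gradient f x - gradient f y‖ ≤ L * ‖x - y‖) {z : E} (hz : ∀ y, f z ≤ f y)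
    (x : E) : ‖gradient f x‖ ^ 2 ≤ 2 * L * (f x - f z) := by
  have h := (hz _).trans
    (le_add_inner_gradient_add_of_smooth hf hs x (-(L⁻¹ • gradient f x)))
  rw [inner_neg_right, real_inner_smul_right, real_inner_self_eq_norm_sq, norm_neg, norm_smul,
    Real.norm_of_nonneg (inv_nonneg.2 hL.le)] at h
  have h' := mul_le_mul_of_nonneg_left h (mul_nonneg zero_le_two hL.le)
  field_simp at h'
  linarith

/-- A gradient step of length at most `1 / L` does not increase the distance to a minimizer. -/
theorem norm_gradient_step_sub_le (hL : 0 < L) (hf : Differentiable ℝ f)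
    (hc : ConvexOn ℝ Set.univ f)
    (hs : ∀ x y, ‖gradient f x - gradient f y‖ ≤ L * ‖x - y‖) {z : E} (hz : ∀ y, f z ≤ f y)
    {η : ℝ} (hη0 : 0 ≤ η) (hη1 : η ≤ 1 / L) (x : E) :
    ‖x - η • gradient f x - z‖ ≤ ‖x - z‖ := by
  have htangent := hc.add_inner_gradient_le_s5 hf x z
  rw [← neg_sub x z, inner_neg_right] at htangent
  have hgrad := sq_norm_gradient_le_of_smooth_of_isMinOn hL hf hs hz x
  have hηL : η * L ≤ 1 := (le_div_iff₀ hL).1 hη1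
  have hstep : η * ‖gradient f x‖ ^ 2 ≤ 2 * ⟪gradient f x, x - z⟫ := calc
    η * ‖gradient f x‖ ^ 2 ≤ η * (2 * L * (f x - f z)) := by gcongr
    _ = η * L * (2 * (f x - f z)) := by ring
    _ ≤ 1 * (2 * (f x - f z)) := by gcongr; linarith [hz x]
    _ ≤ 2 * ⟪gradient f x, x - z⟫ := by linarith
  refine (sq_le_sq₀ (norm_nonneg _) (norm_nonneg _)).1 ?_
  rw [sub_right_comm, norm_sub_sq_real, real_inner_smul_right, real_inner_comm, norm_smul,
    Real.norm_of_nonneg hη0]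
  linarith [mul_le_mul_of_nonneg_left hstep hη0]

end SmoothConvex

/-- Local gradient-descent iterates at each client stay within the initial distance of a
common minimizer, on average: `(1/U) ∑_u ‖x_u^{(τ)} − θ*‖² ≤ ‖θ − θ*‖²`. -/
theorem local_iterates_dist_le {E : Type*} [NormedAddCommGroup E]
    [InnerProductSpace ℝ E] [CompleteSpace E]
    (U : ℕ) (hU : 1 ≤ U) (F : Fin U → E → ℝ) (L : ℝ) (hL : 0 < L)
    (hdiff : ∀ u, Differentiable ℝ (F u))
    (hconv : ∀ u, ConvexOn ℝ Set.univ (F u))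
    (hsmooth : ∀ u, ∀ x y : E, ‖gradient (F u) x - gradient (F u) y‖ ≤ L * ‖x - y‖)
    (θstar : E) (hmin : ∀ u, ∀ θ : E, F u θstar ≤ F u θ)
    (θ : E) (η : ℝ) (hη0 : 0 ≤ η) (hη1 : η ≤ 1 / L)
    (τ : ℕ) (hτ : 1 ≤ τ)
    (x : Fin U → ℕ → E)
    (hx0 : ∀ u, x u 0 = θ)
    (hxstep : ∀ u, ∀ k < τ, x u (k + 1) = x u k - η • gradient (F u) (x u k)) :
    (1 / (U : ℝ)) * ∑ u : Fin U, ‖x u τ - θstar‖ ^ 2 ≤ ‖θ - θstar‖ ^ 2 := by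
  have hdist (u : Fin U) : ∀ k ≤ τ, ‖x u k - θstar‖ ≤ ‖θ - θstar‖ := by
    intro k
    induction k with
    | zero => simp [hx0]
    | succ k ih =>
      intro hk
      rw [hxstep u k hk]
      exact (norm_gradient_step_sub_le hL (hdiff u) (hconv u) (hsmooth u) (hmin u) hη0 hη1
        _).trans (ih (Nat.le_of_succ_le hk))
  have hU' : (0 : ℝ) < U := by exact_mod_cast hU
  rw [one_div, inv_mul_le_iff₀ hU']
  calc
    ∑ u : Fin U, ‖x u τ - θstar‖ ^ 2 ≤ ∑ _u : Fin U, ‖θ - θstar‖ ^ 2 := by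
      gcongr with u
      exact hdist u τ le_rfl
    _ = U * ‖θ - θstar‖ ^ 2 := by simp
end
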